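/- For every n ≥ 1, the polynomial P_n(x) = Σ_{π ∈ S_n, suc(π)=0} x^{asc(π)+1} is bi-γ-positive: there exist nonnegative real numbers a_k (0 ≤ k ≤ ⌊n/2⌋) and b_k (0 ≤ k ≤ ⌊(n−1)/2⌋) such that P_n(x) = Σ_k a_k x^k (1+x)^{n−2k} + Σ_k b_k x^{k+1} (1+x)^{n−1−2k}. -/

import Mathlib

open Finset

namespace SucEuler

/-- One-line notation word of a permutation: `word π i` is the value (in `1..n`)
at position `i ∈ {1,…,n}`, and `0` for positions outside `{1,…,n}`
(this implements the conventions `π(0)=π(n+1)=0`). -/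
def word {n : ℕ} (π : Equiv.Perm (Fin n)) (i : ℕ) : ℕ :=
  if h : 1 ≤ i ∧ i ≤ n then ((π ⟨i - 1, by omega⟩ : Fin n) : ℕ) + 1 else 0

/-- number of descents -/
def des {n : ℕ} (π : Equiv.Perm (Fin n)) : ℕ :=
  ((Finset.Icc 1 (n - 1)).filter fun i => word π (i + 1) < word π i).card

/-- number of ascents -/
def asc {n : ℕ} (π : Equiv.Perm (Fin n)) : ℕ :=
  ((Finset.Icc 1 (n - 1)).filter fun i => word π i < word π (i + 1)).card

/-- number of successions -/
def suc {n : ℕ} (π : Equiv.Perm (Fin n)) : ℕ :=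
  ((Finset.Icc 1 (n - 1)).filter fun i => word π (i + 1) = word π i + 1).card

/-- number of big ascents -/
def basc {n : ℕ} (π : Equiv.Perm (Fin n)) : ℕ :=
  ((Finset.Icc 1 (n - 1)).filter fun i => word π i + 2 ≤ word π (i + 1)).card

/-- number of excedances -/
def excStat {n : ℕ} (σ : Equiv.Perm (Fin n)) : ℕ :=
  (Finset.univ.filter fun i : Fin n => i < σ i).card

/-- number of fixed points -/
def fixStat {n : ℕ} (σ : Equiv.Perm (Fin n)) : ℕ :=
  (Finset.univ.filter fun i : Fin n => σ i = i).card

/-- number of drops -/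
def dropStat {n : ℕ} (σ : Equiv.Perm (Fin n)) : ℕ :=
  (Finset.univ.filter fun i : Fin n => σ i < i).card

/-- number of excedances at positions `i ≥ 2` -/
def excHat {n : ℕ} (σ : Equiv.Perm (Fin n)) : ℕ :=
  (Finset.univ.filter fun i : Fin n => 0 < (i : ℕ) ∧ i < σ i).card

/-- number of fixed points other than `1` -/
def fixHat {n : ℕ} (σ : Equiv.Perm (Fin n)) : ℕ :=
  (Finset.univ.filter fun i : Fin n => 0 < (i : ℕ) ∧ σ i = i).card

/-- number of cycles (orbits) of a permutation -/
def cyc {n : ℕ} (σ : Equiv.Perm (Fin n)) : ℕ :=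
  σ.cycleType.card + fixStat σ

/-- number of cycle double ascents: values `x` with `σ⁻¹(x) < x < σ(x)` -/
def cda {n : ℕ} (σ : Equiv.Perm (Fin n)) : ℕ :=
  (Finset.univ.filter fun x : Fin n => σ⁻¹ x < x ∧ x < σ x).card

open Classical in
/-- number of left-to-right minima -/
noncomputable def lrmin {n : ℕ} (π : Equiv.Perm (Fin n)) : ℕ :=
  ((Finset.Icc 1 n).filter fun i => ∀ j ∈ Finset.Icc 1 n, j < i → word π i < word π j).card

open Classical in
/-- number of proper left-to-right minima -/
noncomputable def plrmin {n : ℕ} (π : Equiv.Perm (Fin n)) : ℕ :=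
  ((Finset.Icc 1 n).filter fun i =>
    (∀ j ∈ Finset.Icc 1 n, j < i → word π i < word π j) ∧ word π i ≠ 1 ∧
      ∃ k ∈ Finset.Icc 1 n, i < k ∧ word π k = word π i - 1 ∧ word π (k + 1) < word π k).card

open Classical in
/-- number of simsun successions -/
noncomputable def simsuc {n : ℕ} (π : Equiv.Perm (Fin n)) : ℕ :=
  ((Finset.Icc 1 n).filter fun i =>
    ∃ j ∈ Finset.Icc 1 n, i < j ∧ word π j = word π i + 1 ∧
      ∀ k ∈ Finset.Icc 1 n, i < k → k < j → word π i + 1 < word π k).card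

/-- number of peaks (with the boundary conventions `π(0)=π(n+1)=0`) -/
def pk {n : ℕ} (π : Equiv.Perm (Fin n)) : ℕ :=
  ((Finset.Icc 1 n).filter fun i => word π (i - 1) < word π i ∧ word π (i + 1) < word π i).card

/-- number of valleys -/
def valStat {n : ℕ} (π : Equiv.Perm (Fin n)) : ℕ :=
  ((Finset.Icc 1 n).filter fun i => word π i < word π (i - 1) ∧ word π i < word π (i + 1)).card

/-- number of double ascents -/
def dasc {n : ℕ} (π : Equiv.Perm (Fin n)) : ℕ :=
  ((Finset.Icc 1 n).filter fun i => word π (i - 1) < word π i ∧ word π i < word π (i + 1)).card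

/-- number of double descents -/
def ddes {n : ℕ} (π : Equiv.Perm (Fin n)) : ℕ :=
  ((Finset.Icc 1 n).filter fun i => word π (i + 1) < word π i ∧ word π i < word π (i - 1)).card

open Classical in
/-- `nextVal σ m x` is the (0-indexed) first value `≤ m` (i.e. `< m` in 0-indexed terms)
in the forward orbit of `x` under `σ`: it equals `σ^t(x)` for the minimal `t ≥ 1`
with `σ^t(x) < m`, when such `t` exists. This is the action of the permutation `σ_k`
(with `m = n - k`) obtained by removing the `k` largest letters from the cycles of `σ`. -/
noncomputable def nextVal {n : ℕ} (σ : Equiv.Perm (Fin n)) (m : ℕ) (x : Fin n) : ℕ :=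
  if h : ∃ t : ℕ, 0 < t ∧ (((σ ^ t) x : Fin n) : ℕ) < m then (((σ ^ Nat.find h) x : Fin n) : ℕ)
  else 0

/-- `σ` is a simsun permutation of the second kind: for every `0 ≤ k ≤ n-1`, the
permutation of `[n-k]` obtained from `σ` by removing the `k` largest letters has
no cycle double ascents. (Here `m = n - k` and values are 0-indexed.) -/
def IsSimsun2 {n : ℕ} (σ : Equiv.Perm (Fin n)) : Prop :=
  ∀ m ≤ n, ∀ x : Fin n, (x : ℕ) < m →
    ¬ (nextVal σ⁻¹ m x < (x : ℕ) ∧ (x : ℕ) < nextVal σ m x)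

noncomputable instance {n : ℕ} : DecidablePred (IsSimsun2 (n := n)) :=
  fun _ => Classical.propDecidable _

/-- the derangement polynomial `d_n(x)` -/
def dpoly (n : ℕ) (x : ℝ) : ℝ :=
  ∑ σ ∈ Finset.univ.filter fun σ : Equiv.Perm (Fin n) => fixStat σ = 0, x ^ excStat σ

/-- the Eulerian polynomial `A_n(x)` -/
def eulerian (n : ℕ) (x : ℝ) : ℝ :=
  ∑ π : Equiv.Perm (Fin n), x ^ des π


open Polynomial in
inductive BG : ℕ → ℝ[X] → Prop
  | zero (n : ℕ) : BG n 0
  | add (n : ℕ) (p q : ℝ[X]) : BG n p → BG n q → BG n (p + q)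
  | ma (n k : ℕ) (c : ℝ) (hc : 0 ≤ c) (h : 2 * k ≤ n) :
      BG n (C c * X ^ k * (1 + X) ^ (n - 2 * k))
  | mb (n k : ℕ) (c : ℝ) (hc : 0 ≤ c) (h : 2 * k + 1 ≤ n) :
      BG n (C c * X ^ (k + 1) * (1 + X) ^ (n - 1 - 2 * k))

open Polynomial in
lemma BG.smul {n : ℕ} {p : ℝ[X]} (h : BG n p) (d : ℝ) (hd : 0 ≤ d) : BG n (C d * p) := by
  induction h with
  | zero => simpa using BG.zero n
  | add p q _ _ hp hq => rw [mul_add]; exact BG.add _ _ _ hp hq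
  | ma k c hc h =>
    have := BG.ma n k (d * c) (mul_nonneg hd hc) h
    rw [C_mul] at this; simpa [mul_assoc] using this
  | mb k c hc h =>
    have := BG.mb n k (d * c) (mul_nonneg hd hc) h
    rw [C_mul] at this; simpa [mul_assoc] using this

open Polynomial in
lemma BG.mulX {n : ℕ} {p : ℝ[X]} (h : BG n p) : BG (n + 2) (X * p) := by
  induction h with
  | zero => simpa using BG.zero _
  | add p q _ _ hp hq => rw [mul_add]; exact BG.add _ _ _ hp hq
  | ma k c hc h =>
    have := BG.ma (n + 2) (k + 1) c hc (by omega)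
    convert this using 1
    rw [show n + 2 - 2 * (k + 1) = n - 2 * k by omega]; ring
  | mb k c hc h =>
    have := BG.mb (n + 2) (k + 1) c hc (by omega)
    convert this using 1
    rw [show n + 2 - 1 - 2 * (k + 1) = n - 1 - 2 * k by omega]; ring

open Polynomial in
noncomputable def TT (n : ℕ) (p : ℝ[X]) : ℝ[X] := (n : ℝ[X]) * X * p + X * (1 - X) * derivative p

open Polynomial in
lemma TT_mono (m k : ℕ) (c : ℝ) : TT (m + 2 * k) (C c * X ^ k * (1 + X) ^ m) =
    C (k * c) * X ^ k * (1 + X) ^ (m + 1) + (if m = 0 then 0 else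
      C (2 * m * c) * X ^ (k + 1) * (1 + X) ^ (m - 1)) := by
  have h2 : (C (2 : ℝ) : ℝ[X]) = 2 := map_ofNat C 2
  unfold TT
  rcases m with _ | m <;> rcases k with _ | k
  · simp
  · simp [derivative_mul, derivative_X_pow]; ring
  · simp [derivative_mul, derivative_pow, h2]; ring
  · simp [derivative_mul, derivative_pow, h2]; ring

open Polynomial in
lemma BG.tt {n : ℕ} {p : ℝ[X]} (h : BG n p) : BG (n + 1) (TT n p) := by
  induction h with
  | zero => simpa [TT] using BG.zero _
  | add p q _ _ hp hq =>
    have := BG.add _ _ _ hp hq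
    convert this using 1
    simp [TT]; ring
  | ma k c hc h =>
    obtain ⟨m, rfl⟩ : ∃ m, n = m + 2 * k := ⟨n - 2 * k, by omega⟩
    rw [show m + 2 * k - 2 * k = m by omega, TT_mono]
    refine BG.add _ _ _ ?_ ?_
    · have := BG.ma (m + 2 * k + 1) k (k * c) (by positivity) (by omega)
      rwa [show m + 2 * k + 1 - 2 * k = m + 1 by omega] at this
    · split_ifs with h0
      · exact BG.zero _
      · have := BG.ma (m + 2 * k + 1) (k + 1) (2 * m * c) (by positivity) (by omega)
        rwa [show m + 2 * k + 1 - 2 * (k + 1) = m - 1 by omega] at this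
  | mb k c hc h =>
    obtain ⟨m, rfl⟩ : ∃ m, n = m + 2 * k + 1 := ⟨n - 2 * k - 1, by omega⟩
    rw [show m + 2 * k + 1 - 1 - 2 * k = m by omega]
    have e : TT (m + 2 * k + 1) (C c * X ^ (k + 1) * (1 + X) ^ m) =
        X * TT (m + 2 * k) (C c * X ^ k * (1 + X) ^ m) + C c * X ^ (k + 1) * (1 + X) ^ m := by
      rw [show C c * X ^ (k + 1) * (1 + X) ^ m = X * (C c * X ^ k * (1 + X) ^ m) by ring]
      unfold TT
      rw [derivative_mul, derivative_X]
      push_cast; ring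
    rw [e, TT_mono, mul_add]
    refine BG.add _ _ _ (BG.add _ _ _ ?_ ?_) ?_
    · have := BG.mb (m + 2 * k + 1 + 1) k (k * c) (by positivity) (by omega)
      rw [show m + 2 * k + 1 + 1 - 1 - 2 * k = m + 1 by omega] at this
      convert this using 1; ring
    · split_ifs with h0
      · simpa using BG.zero _
      · have := BG.mb (m + 2 * k + 1 + 1) (k + 1) (2 * m * c) (by positivity) (by omega)
        rw [show m + 2 * k + 1 + 1 - 1 - 2 * (k + 1) = m - 1 by omega] at this
        convert this using 1; ring
    · have := BG.ma (m + 2 * k + 1 + 1) (k + 1) c hc (by omega)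
      rwa [show m + 2 * k + 1 + 1 - 2 * (k + 1) = m by omega] at this

open Polynomial in
lemma BG.final {n : ℕ} {p : ℝ[X]} (h : BG n p) :
    ∃ a b : ℕ → ℝ, (∀ k, 0 ≤ a k) ∧ (∀ k, 0 ≤ b k) ∧
      ∀ x : ℝ, p.eval x =
          (∑ k ∈ Finset.range (n / 2 + 1), a k * x ^ k * (1 + x) ^ (n - 2 * k)) +
            ∑ k ∈ Finset.range ((n - 1) / 2 + 1), b k * x ^ (k + 1) * (1 + x) ^ (n - 1 - 2 * k) := by
  induction h with
  | zero => exact ⟨0, 0, by simp, by simp, by simp⟩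
  | add p q _ _ hp hq =>
    obtain ⟨a, b, ha, hb, h⟩ := hp
    obtain ⟨a', b', ha', hb', h'⟩ := hq
    refine ⟨a + a', b + b', fun k => add_nonneg (ha k) (ha' k),
      fun k => add_nonneg (hb k) (hb' k), fun x => ?_⟩
    simp only [eval_add, h, h', Pi.add_apply, add_mul, Finset.sum_add_distrib]
    ring
  | ma k c hc h =>
    refine ⟨fun i => if i = k then c else 0, 0, fun i => by dsimp only; split_ifs <;> simp [hc], by simp, fun x => ?_⟩
    simp only [ite_mul, zero_mul, Finset.sum_ite_eq', Pi.zero_apply, Finset.sum_const_zero]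
    rw [if_pos (by simp; omega)]; simp
  | mb k c hc h =>
    refine ⟨0, fun i => if i = k then c else 0, by simp, fun i => by dsimp only; split_ifs <;> simp [hc], fun x => ?_⟩
    simp only [ite_mul, zero_mul, Finset.sum_ite_eq', Pi.zero_apply, Finset.sum_const_zero]
    rw [if_pos (by simp; omega)]; simp

/-! insertion -/

def insW (w : ℕ → ℕ) (p v : ℕ) (i : ℕ) : ℕ :=
  if i ≤ p then w i else if i = p + 1 then v else w (i - 1)

lemma insW_sum (g : ℕ → ℕ → ℤ) (w : ℕ → ℕ) (p v d : ℕ) :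
    ∑ i ∈ range (p + d + 2), g (insW w p v i) (insW w p v (i + 1)) =
      ∑ i ∈ range (p + d + 1), g (w i) (w (i + 1)) - g (w p) (w (p + 1)) + g (w p) v
        + g v (w (p + 1)) := by
  induction d with
  | zero =>
    rw [add_zero, sum_range_succ, sum_range_succ, sum_range_succ]
    have : ∑ i ∈ range p, g (insW w p v i) (insW w p v (i + 1)) =
        ∑ i ∈ range p, g (w i) (w (i + 1)) := by
      refine sum_congr rfl fun i hi => ?_
      rw [mem_range] at hi
      simp [insW, hi.le, Nat.succ_le_of_lt hi]
    rw [this]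
    simp [insW]
  | succ d ih =>
    rw [show p + (d + 1) + 2 = (p + d + 2) + 1 by ring, sum_range_succ, ih,
      show p + (d + 1) + 1 = (p + d + 1) + 1 by ring, sum_range_succ _ (p + d + 1)]
    have h1 : insW w p v (p + d + 2) = w (p + d + 1) := by
      unfold insW; rw [if_neg (by omega), if_neg (by omega)]; rfl
    have h2 : insW w p v (p + d + 2 + 1) = w (p + d + 1 + 1) := by
      unfold insW; rw [if_neg (by omega), if_neg (by omega)]; rfl
    rw [h1, h2]; ring

lemma word_zero {n : ℕ} (π : Equiv.Perm (Fin n)) : word π 0 = 0 := by simp [word]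
lemma word_big {n : ℕ} (π : Equiv.Perm (Fin n)) : word π (n + 1) = 0 := by simp [word]
lemma word_le {n : ℕ} (π : Equiv.Perm (Fin n)) (i : ℕ) : word π i ≤ n := by
  unfold word; split_ifs <;> omega
lemma word_pos {n : ℕ} (π : Equiv.Perm (Fin n)) (i : ℕ) (h : 1 ≤ i) (h' : i ≤ n) :
    1 ≤ word π i := by
  unfold word; rw [dif_pos ⟨h, h'⟩]; omega

def gA (x y : ℕ) : ℤ := if x < y then 1 else 0
def gS (x y : ℕ) : ℤ := if 1 ≤ x ∧ y = x + 1 then 1 else 0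

lemma range_split (n : ℕ) (hn : 1 ≤ n) (f : ℕ → ℤ) :
    ∑ i ∈ range (n + 1), f i = f 0 + ∑ i ∈ Icc 1 (n - 1), f i + f n := by
  obtain ⟨m, rfl⟩ : ∃ m, n = m + 1 := ⟨n - 1, by omega⟩
  rw [sum_range_succ, Finset.range_eq_Ico, Finset.sum_eq_sum_Ico_succ_bot (by omega)]
  rfl

lemma asc_sum {n : ℕ} (hn : 1 ≤ n) (π : Equiv.Perm (Fin n)) :
    ∑ i ∈ range (n + 1), gA (word π i) (word π (i + 1)) = asc π + 1 := by
  rw [range_split n hn, word_zero, word_big]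
  have := word_pos π 1 le_rfl hn
  rw [show gA 0 (word π (0 + 1)) = 1 by simp [gA]; omega,
    show gA (word π n) 0 = 0 by simp [gA]]
  simp [asc, gA]; ring

lemma suc_sum {n : ℕ} (hn : 1 ≤ n) (π : Equiv.Perm (Fin n)) :
    ∑ i ∈ range (n + 1), gS (word π i) (word π (i + 1)) = suc π := by
  rw [range_split n hn, word_zero, word_big]
  have : ∑ i ∈ Icc 1 (n - 1), gS (word π i) (word π (i + 1)) =
      ∑ i ∈ Icc 1 (n - 1), if word π (i + 1) = word π i + 1 then 1 else 0 := by
    refine sum_congr rfl fun i hi => ?_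
    rw [mem_Icc] at hi
    simp [gS, word_pos π i hi.1 (by omega)]
  rw [this]
  simp [suc, gS]

lemma max_sum {n : ℕ} (hn : 1 ≤ n) (π : Equiv.Perm (Fin n)) :
    ∑ i ∈ range (n + 1), (if word π i = n then (1 : ℤ) else 0) = 1 := by
  obtain ⟨m, rfl⟩ : ∃ m, n = m + 1 := ⟨n - 1, by omega⟩
  rw [sum_range_succ', word_zero]
  simp only [Nat.zero_ne_add_one, if_false, add_zero]
  rw [← Fin.sum_univ_eq_sum_range (fun i => if word π (i + 1) = m + 1 then (1 : ℤ) else 0)]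
  have : ∀ i : Fin (m + 1), (if word π ((i : ℕ) + 1) = m + 1 then (1 : ℤ) else 0) =
      if i = π.symm (Fin.last m) then 1 else 0 := by
    intro i
    congr 1
    rw [Equiv.eq_symm_apply]
    have : (i : ℕ) + 1 ≤ m + 1 := i.2
    simp [word, this, Fin.ext_iff]
  simp [this]

def ins {n : ℕ} (p : Fin (n + 1)) (σ : Equiv.Perm (Fin n)) : Equiv.Perm (Fin (n + 1)) :=
  (finSuccEquiv' p).trans ((Equiv.optionCongr σ).trans (finSuccEquiv' (Fin.last n)).symm)

lemma ins_at {n : ℕ} (p : Fin (n + 1)) (σ : Equiv.Perm (Fin n)) : ins p σ p = Fin.last n := by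
  simp [ins]
lemma ins_above {n : ℕ} (p : Fin (n + 1)) (σ : Equiv.Perm (Fin n)) (i : Fin n) :
    ins p σ (p.succAbove i) = (σ i).castSucc := by
  simp [ins]

lemma ins_bij (n : ℕ) : Function.Bijective
    (fun x : Fin (n + 1) × Equiv.Perm (Fin n) => ins x.1 x.2) := by
  rw [Fintype.bijective_iff_injective_and_card]
  constructor
  · rintro ⟨p, σ⟩ ⟨q, τ⟩ h
    dsimp only at h
    have hpq : p = q := by
      apply (ins q τ).injective
      rw [ins_at, ← h, ins_at]
    subst hpq
    have : σ = τ := by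
      ext i
      have := ins_above p σ i
      rw [h, ins_above] at this
      simpa [Fin.ext_iff] using this.symm
    rw [this]
  · simp [Fintype.card_perm, Nat.factorial_succ]

lemma word_ins {n : ℕ} (p : Fin (n + 1)) (σ : Equiv.Perm (Fin n)) (i : ℕ) (hi : i ≤ n + 2) :
    word (ins p σ) i = insW (word σ) p (n + 1) i := by
  have hp : (p : ℕ) ≤ n := by omega
  unfold insW
  rcases Nat.eq_zero_or_pos i with rfl | h0
  · simp [word_zero]
  by_cases hi2 : i = n + 2
  · subst hi2
    rw [if_neg (by omega), if_neg (by omega), word_big]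
    exact (word_big σ).symm
  have hi3 : i - 1 < n + 1 := by omega
  have hw : word (ins p σ) i = (ins p σ ⟨i - 1, hi3⟩ : ℕ) + 1 := by
    unfold word; rw [dif_pos ⟨h0, by omega⟩]
  rw [hw]
  split_ifs with h1 h2
  · have : (⟨i - 1, hi3⟩ : Fin (n + 1)) = p.succAbove ⟨i - 1, by omega⟩ := by
      rw [Fin.succAbove_of_castSucc_lt]
      · rfl
      · simp [Fin.lt_def]; omega
    rw [this, ins_above]
    unfold word; rw [dif_pos ⟨h0, by omega⟩]; rfl
  · have : (⟨i - 1, hi3⟩ : Fin (n + 1)) = p := by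
      ext; simp; omega
    rw [this, ins_at]; rfl
  · have : (⟨i - 1, hi3⟩ : Fin (n + 1)) = p.succAbove ⟨i - 1 - 1, by omega⟩ := by
      rw [Fin.succAbove_of_le_castSucc]
      · ext; simp; omega
      · simp [Fin.le_def]; omega
    rw [this, ins_above]
    unfold word; rw [dif_pos ⟨by omega, by omega⟩]; rfl

lemma ins_sum {n : ℕ} (g : ℕ → ℕ → ℤ) (p : Fin (n + 1)) (σ : Equiv.Perm (Fin n)) :
    ∑ i ∈ range (n + 2), g (word (ins p σ) i) (word (ins p σ) (i + 1)) =
      ∑ i ∈ range (n + 1), g (word σ i) (word σ (i + 1)) - g (word σ p) (word σ (p + 1))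
        + g (word σ p) (n + 1) + g (n + 1) (word σ (p + 1)) := by
  have h := insW_sum g (word σ) p (n + 1) (n - p)
  rw [show (p : ℕ) + (n - p) = n by omega] at h
  rw [← h]
  refine sum_congr rfl fun i hi => ?_
  rw [mem_range] at hi
  rw [word_ins _ _ _ (by omega), word_ins _ _ _ (by omega)]

lemma asc_ins {n : ℕ} (hn : 1 ≤ n) (p : Fin (n + 1)) (σ : Equiv.Perm (Fin n)) :
    (asc (ins p σ) : ℤ) = asc σ + 1 - gA (word σ p) (word σ (p + 1)) := by
  have h := ins_sum gA p σ
  rw [asc_sum hn, asc_sum (by omega)] at h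
  have h1 := word_le σ p
  have h2 := word_le σ (p + 1)
  rw [show gA (word σ p) (n + 1) = 1 by simp [gA]; omega,
    show gA (n + 1) (word σ (p + 1)) = 0 by simp [gA]; omega] at h
  linarith

lemma suc_ins {n : ℕ} (hn : 1 ≤ n) (p : Fin (n + 1)) (σ : Equiv.Perm (Fin n)) :
    (suc (ins p σ) : ℤ) = suc σ - gS (word σ p) (word σ (p + 1))
      + if word σ p = n then 1 else 0 := by
  have h := ins_sum gS p σ
  rw [suc_sum hn, suc_sum (by omega)] at h
  have h1 := word_le σ p
  have h2 := word_le σ (p + 1)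
  rw [show gS (word σ p) (n + 1) = if word σ p = n then 1 else 0 by
      unfold gS; congr 1; simp; omega,
    show gS (n + 1) (word σ (p + 1)) = 0 by simp [gS]; omega] at h
  linarith

lemma f_ins {R : Type*} [CommRing R] (f : ℕ → ℕ → R) {n : ℕ} (hn : 1 ≤ n) (p : Fin (n + 1))
    (σ : Equiv.Perm (Fin n)) :
    f (asc (ins p σ)) (suc (ins p σ)) = f (asc σ + 1) (suc σ)
      + (gA (word σ p) (word σ (p + 1)) : R) * (f (asc σ) (suc σ) - f (asc σ + 1) (suc σ))
      + (gS (word σ p) (word σ (p + 1)) : R) * (f (asc σ) (suc σ - 1) - f (asc σ) (suc σ))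
      + ((if word σ p = n then 1 else 0 : ℤ) : R) *
        (f (asc σ + 1) (suc σ + 1) - f (asc σ + 1) (suc σ)) := by
  have h1 := word_le σ p
  have h2 := word_le σ (p + 1)
  have ha := asc_ins hn p σ
  have hs := suc_ins hn p σ
  unfold gA at *
  unfold gS at *
  by_cases c3 : word σ p = n
  · have c1 : ¬ word σ p < word σ (p + 1) := by omega
    have c2 : ¬ (1 ≤ word σ p ∧ word σ (p + 1) = word σ p + 1) := by omega
    rw [if_neg c1] at ha ⊢
    rw [if_neg c2, if_pos c3] at hs ⊢
    rw [show asc (ins p σ) = asc σ + 1 by omega, show suc (ins p σ) = suc σ + 1 by omega]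
    simp
  · by_cases c2 : 1 ≤ word σ p ∧ word σ (p + 1) = word σ p + 1
    · have c1 : word σ p < word σ (p + 1) := by omega
      rw [if_pos c1] at ha ⊢
      rw [if_pos c2, if_neg c3] at hs ⊢
      rw [show asc (ins p σ) = asc σ by omega, show suc (ins p σ) = suc σ - 1 by omega]
      simp
    · rw [if_neg c2, if_neg c3] at hs ⊢
      rw [show suc (ins p σ) = suc σ by omega]
      by_cases c1 : word σ p < word σ (p + 1)
      · rw [if_pos c1] at ha ⊢
        rw [show asc (ins p σ) = asc σ by omega]; simp
      · rw [if_neg c1] at ha ⊢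
        rw [show asc (ins p σ) = asc σ + 1 by omega]; simp

lemma f_sum {R : Type*} [CommRing R] (f : ℕ → ℕ → R) {n : ℕ} (hn : 1 ≤ n) :
    ∑ π : Equiv.Perm (Fin (n + 1)), f (asc π) (suc π) =
      ∑ σ : Equiv.Perm (Fin n), ((n + 1 : R) * f (asc σ + 1) (suc σ)
      + (asc σ + 1 : R) * (f (asc σ) (suc σ) - f (asc σ + 1) (suc σ))
      + (suc σ : R) * (f (asc σ) (suc σ - 1) - f (asc σ) (suc σ))
      + (f (asc σ + 1) (suc σ + 1) - f (asc σ + 1) (suc σ))) := by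
  rw [← (ins_bij n).sum_comp (fun π => f (asc π) (suc π)), Fintype.sum_prod_type_right]
  refine sum_congr rfl fun σ _ => ?_
  simp only [f_ins f hn, sum_add_distrib, ← sum_mul]
  have hA := congrArg (Int.cast : ℤ → R) (asc_sum hn σ)
  have hS := congrArg (Int.cast : ℤ → R) (suc_sum hn σ)
  have hM := congrArg (Int.cast : ℤ → R) (max_sum hn σ)
  rw [← Fin.sum_univ_eq_sum_range (fun i => gA (word σ i) (word σ (i + 1)))] at hA
  rw [← Fin.sum_univ_eq_sum_range (fun i => gS (word σ i) (word σ (i + 1)))] at hS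
  rw [← Fin.sum_univ_eq_sum_range (fun i => if word σ i = n then (1 : ℤ) else 0)] at hM
  rw [Int.cast_sum] at hA hS hM
  rw [hA, hS, hM]
  simp

open Polynomial in
noncomputable def PP (n j : ℕ) : ℝ[X] :=
  ∑ π : Equiv.Perm (Fin n), if suc π = j then X ^ (asc π + 1) else 0

open Polynomial in
lemma PP_rec (n j : ℕ) (hn : 1 ≤ n) :
    PP (n + 1) j = TT n (PP n j) + (j + 1 : ℝ[X]) * PP n (j + 1) - (j : ℝ[X]) * PP n j
      + if j = 0 then 0 else X * PP n (j - 1) := by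
  have h := f_sum (fun a s => if s = j then (X : ℝ[X]) ^ (a + 1) else 0) hn
  have e : (if j = 0 then 0 else X * PP n (j - 1)) =
      ∑ σ : Equiv.Perm (Fin n), if suc σ + 1 = j then (X : ℝ[X]) ^ (asc σ + 2) else 0 := by
    split_ifs with hj
    · subst hj; simp
    · unfold PP
      rw [mul_sum]
      refine sum_congr rfl fun σ _ => ?_
      by_cases hh : suc σ + 1 = j
      · rw [if_pos hh, if_pos (by omega)]; ring
      · rw [if_neg hh, if_neg (by omega)]; ring
  rw [e]
  unfold PP TT
  rw [h, derivative_sum]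
  simp only [mul_sum, ← sum_add_distrib, ← sum_sub_distrib]
  refine sum_congr rfl fun σ _ => ?_
  generalize suc σ = s
  generalize asc σ = a
  by_cases h1 : s = j
  · subst h1
    have : s - 1 = s ↔ s = 0 := by omega
    rcases s with _ | s
    · simp [derivative_X_pow]; ring
    · simp [derivative_X_pow]; ring
  · by_cases h2 : s = j + 1
    · subst h2
      simp; 
    · by_cases h3 : s + 1 = j
      · subst h3
        simp; 
        omega
      · have : s = 0 ∨ s - 1 ≠ j := by omega
        rcases this with h4 | h4
        · subst h4; simp [h1, h2, h3]
        · simp [h1, h2, h3, h4]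

open Polynomial in
lemma PP_one (j : ℕ) : PP 1 j = if j = 0 then X else 0 := by
  unfold PP
  simp [suc, asc, eq_comm]

open Polynomial in
lemma PP_succ (n : ℕ) : ∀ j : ℕ, (j + 1 : ℝ[X]) * PP (n + 1) (j + 1) = (n : ℝ[X]) * X * PP n j := by
  induction n with
  | zero => intro j; simp [PP_one]
  | succ n ih =>
    intro j
    rw [PP_rec (n + 1) (j + 1) (by omega)]
    have h1 := ih j
    have h2 := ih (j + 1)
    have h3 := congrArg derivative h1
    have h4 : (j : ℝ[X]) * PP (n + 1) j = (n : ℝ[X]) * X * (if j = 0 then 0 else PP n (j - 1)) := by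
      rcases j with _ | j
      · simp
      · simpa using ih j
    have h5 : (n : ℝ[X]) * PP (n + 1) j = (n : ℝ[X]) * (TT n (PP n j) + (j + 1 : ℝ[X]) * PP n (j + 1)
        - (j : ℝ[X]) * PP n j + X * (if j = 0 then 0 else PP n (j - 1))) := by
      rcases Nat.eq_zero_or_pos n with rfl | hn
      · simp
      · rw [PP_rec n j hn]; simp
    generalize (if j = 0 then 0 else PP n (j - 1)) = G at *
    rw [show (j + 1 : ℝ[X]) = ((j + 1 : ℕ) : ℝ[X]) by push_cast; rfl, derivative_mul,
      derivative_natCast, derivative_mul, derivative_mul, derivative_natCast, derivative_X] at h3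
    unfold TT at *
    simp only [Nat.add_sub_cancel, Nat.succ_ne_zero, if_false]
    push_cast at *
    generalize derivative (PP (n + 1) (j + 1)) = D1 at *
    generalize derivative (PP n j) = D2 at *
    linear_combination ((n + 1) * X - (j + 1)) * h1 + (j + 1) * h2 + X * (1 - X) * h3 + X * h4 - X * h5

open Polynomial in
lemma PP_BG (n : ℕ) : BG (n + 1) (PP (n + 1) 0) ∧ BG (n + 2) (PP (n + 2) 0) := by
  induction n with
  | zero =>
    have h1 : BG 1 (PP 1 0) := by
      have := BG.mb 1 0 1 (by norm_num) (by omega)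
      simpa [PP_one] using this
    refine ⟨h1, ?_⟩
    rw [PP_rec 1 0 le_rfl]
    simpa [PP_one] using h1.tt
  | succ n ih =>
    refine ⟨ih.2, ?_⟩
    rw [PP_rec (n + 2) 0 (by omega)]
    have := PP_succ (n + 1) 0
    simp only [Nat.cast_zero, zero_add] at this
    simp only [Nat.cast_zero, zero_add, this, if_true, zero_mul, sub_zero, add_zero]
    refine BG.add _ _ _ ih.2.tt ?_
    have := ih.1.mulX.smul (n + 1) (by positivity)
    convert this using 1
    simp; ring

/-- `P_n(x) = Σ_{π ∈ S_n, suc(π)=0} x^(asc(π)+1)` is bi-γ-positive. -/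
theorem statement9 (n : ℕ) (hn : 1 ≤ n) :
    ∃ a b : ℕ → ℝ, (∀ k, 0 ≤ a k) ∧ (∀ k, 0 ≤ b k) ∧
      ∀ x : ℝ,
        (∑ π ∈ Finset.univ.filter fun π : Equiv.Perm (Fin n) => suc π = 0, x ^ (asc π + 1)) =
          (∑ k ∈ Finset.range (n / 2 + 1), a k * x ^ k * (1 + x) ^ (n - 2 * k)) +
            ∑ k ∈ Finset.range ((n - 1) / 2 + 1), b k * x ^ (k + 1) * (1 + x) ^ (n - 1 - 2 * k) := by
  obtain ⟨m, rfl⟩ : ∃ m, n = m + 1 := ⟨n - 1, by omega⟩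
  obtain ⟨a, b, ha, hb, h⟩ := (PP_BG m).1.final
  refine ⟨a, b, ha, hb, fun x => ?_⟩
  rw [← h x, PP, Polynomial.eval_finsetSum, Finset.sum_filter]
  refine Finset.sum_congr rfl fun π _ => ?_
  split_ifs <;> simp

end SucEuler
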